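/- arXiv:0810.3136 — 2 statements merged into one kernel-verified Lean document; each statement's English description precedes it below -/
import Mathlib

section
/- Let φ be a satisfiable 3CNF formula over variables α₁, …, α_n with clauses c₁, …, c_m in which some clause contains at least two literals, let K(φ) be the associated graph game, and let x be the imputation assigning payoff 1 to player sat and 0 to every other player. Then x belongs to the kernel of K(φ) if and only if max_{S ∈ I_{chall,sat}} e(S, x) ≤ max_{S ∈ I_{sat,chall}} e(S, x). -/
set_option synthInstance.maxSize 1000
set_option maxHeartbeats 1000000

/-!
The graph game `K(φ)` associated with a 3CNF formula `φ = c₁ ∧ … ∧ c_m` over variables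
`α₁, …, α_n`.  A literal is a pair `(i, b) : Fin n × Bool` (`b = true` for the positive
literal `α_{i+1}`, `b = false` for `¬α_{i+1}`; we use `0`-based indices, so the paper's
variable `α_i` is index `i - 1` and its paper weight `2^i` becomes `2^(i+1)` here).
A clause is the finset of its literals, so `φ` is given by `c : Fin m → Finset (Fin n × Bool)`.

Players: a variable player for each variable, a clause player for each clause, a literal
player for each occurrence of a literal in a clause, and the special players `chall`
(encoded by `false`) and `sat` (encoded by `true`).
-/

/-- Literal occurrences: a literal together with a clause it occurs in. -/
abbrev KLit (n m : ℕ) (c : Fin m → Finset (Fin n × Bool)) :=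
  {p : (Fin n × Bool) × Fin m // p.1 ∈ c p.2}

/-- The players of the graph game `K(φ)`. -/
abbrev KP (n m : ℕ) (c : Fin m → Finset (Fin n × Bool)) :=
  Fin n ⊕ (Fin m ⊕ (KLit n m c ⊕ Bool))

variable {n m : ℕ} (c : Fin m → Finset (Fin n × Bool))

/-- The variable player `α_i`. -/
def KPvar (i : Fin n) : KP n m c := Sum.inl i
/-- The clause player `c_j`. -/
def KPcl (j : Fin m) : KP n m c := Sum.inr (Sum.inl j)
/-- The literal player `ℓ_{i,j}`. -/
def KPlit (l : KLit n m c) : KP n m c := Sum.inr (Sum.inr (Sum.inl l))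
/-- The player `chall`. -/
def KPchall : KP n m c := Sum.inr (Sum.inr (Sum.inr false))
/-- The player `sat`. -/
def KPsat : KP n m c := Sum.inr (Sum.inr (Sum.inr true))

/-- The (symmetric) edge-weight function of `K(φ)`, excluding the normalizer edge
`{chall, sat}`; `Kw0 c u v = 0` when `{u, v}` is not an edge.
Positive edges: `{c_j, ℓ_{i,j}}` of weight `2^(n+3)`; `{chall, α_i}` of weight `2^(i+1)`;
`{sat, α_i}` of weight `2^(i+1)` plus an extra `2^0` for the first variable.
Penalty edges, of weight `-2^(m+n+7)`: pairs of distinct literal occurrences in the same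
clause, opposite occurrences of the same variable, and `{α_i, ¬α_{i,j}}` for each negative
occurrence of a variable. -/
noncomputable def Kw0 : KP n m c → KP n m c → ℝ := fun u v =>
  match u, v with
  | Sum.inr (Sum.inl j), Sum.inr (Sum.inr (Sum.inl l)) =>
      if l.1.2 = j then (2:ℝ)^(n+3) else 0
  | Sum.inr (Sum.inr (Sum.inl l)), Sum.inr (Sum.inl j) =>
      if l.1.2 = j then (2:ℝ)^(n+3) else 0
  | Sum.inl i, Sum.inr (Sum.inr (Sum.inr b)) =>
      (2:ℝ)^((i:ℕ)+1) + (if b = true ∧ (i:ℕ) = 0 then 1 else 0)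
  | Sum.inr (Sum.inr (Sum.inr b)), Sum.inl i =>
      (2:ℝ)^((i:ℕ)+1) + (if b = true ∧ (i:ℕ) = 0 then 1 else 0)
  | Sum.inr (Sum.inr (Sum.inl l)), Sum.inr (Sum.inr (Sum.inl l')) =>
      if (l.1.2 = l'.1.2 ∧ l.1.1 ≠ l'.1.1) ∨ (l.1.1.1 = l'.1.1.1 ∧ l.1.1.2 ≠ l'.1.1.2)
      then -((2:ℝ)^(m+n+7)) else 0
  | Sum.inl i, Sum.inr (Sum.inr (Sum.inl l)) =>
      if l.1.1 = (i, false) then -((2:ℝ)^(m+n+7)) else 0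
  | Sum.inr (Sum.inr (Sum.inl l)), Sum.inl i =>
      if l.1.1 = (i, false) then -((2:ℝ)^(m+n+7)) else 0
  | _, _ => 0

/-- The weight of the normalizer edge `{chall, sat}`:
`1` minus the sum of the weights of all other edges. -/
noncomputable def Kwnorm : ℝ := 1 - (∑ u : KP n m c, ∑ v : KP n m c, Kw0 c u v) / 2

/-- The full (symmetric) edge-weight function of `K(φ)`. -/
noncomputable def Kw (u v : KP n m c) : ℝ :=
  Kw0 c u v +
    (if (u = KPchall c ∧ v = KPsat c) ∨ (u = KPsat c ∧ v = KPchall c) then Kwnorm c else 0)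

/-- The worth of a coalition `S` in the graph game `K(φ)`: the sum of the weights of all
edges contained in `S` (written via the symmetric weight function). -/
noncomputable def Kworth (S : Finset (KP n m c)) : ℝ := (∑ u ∈ S, ∑ v ∈ S, Kw c u v) / 2

/-- The payoff vector assigning `1` to the player `sat` and `0` to every other player. -/
noncomputable def Kx : KP n m c → ℝ := fun p => if p = KPsat c then 1 else 0

/-- `I_{i,j}`: the coalitions containing `i` but not `j`. -/
def KIset (i j : KP n m c) : Finset (Finset (KP n m c)) :=
  Finset.univ.filter (fun S => i ∈ S ∧ j ∉ S)

/-- The surplus `s_{i,j}(x) = max_{S ∈ I_{i,j}} (v(S) - x(S))`.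
(For `i ≠ j` the singleton `{i}` belongs to `I_{i,j}`, so inserting it does not change
the maximum; it merely makes the maximum well defined for all arguments.) -/
noncomputable def Ksurplus (i j : KP n m c) (x : KP n m c → ℝ) : ℝ :=
  (insert {i} (KIset c i j)).sup' (Finset.insert_nonempty _ _)
    (fun S => Kworth c S - ∑ k ∈ S, x k)

/-- `x` is an imputation: efficient and individually rational. -/
def KIsImputation (x : KP n m c → ℝ) : Prop :=
  (∑ p, x p) = Kworth c Finset.univ ∧ ∀ p, x p ≥ Kworth c {p}

/-- Membership in the kernel of the game `K(φ)`. -/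
def KInKernel (x : KP n m c → ℝ) : Prop :=
  KIsImputation c x ∧
    ∀ i j : KP n m c, i ≠ j → Ksurplus c i j x > Ksurplus c j i x → x j = Kworth c {j}

/-- `σ` is a satisfying assignment for `φ`. -/
def KSat (σ : Fin n → Bool) : Prop := ∀ j : Fin m, ∃ l ∈ c j, σ l.1 = l.2

instance : DecidablePred (KSat c) := fun σ => by unfold KSat; infer_instance

/-- The value `∑_{α_i : σ(α_i) = true} 2^i` of an assignment (with `0`-based indices,
the paper's `2^i` is `2^(i+1)` here). -/
noncomputable def Kval (σ : Fin n → Bool) : ℝ :=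
  ∑ i : Fin n, if σ i then (2:ℝ)^((i:ℕ)+1) else 0

/-- `D`: the maximum worth over all coalitions not containing both `chall` and `sat`. -/
noncomputable def KD : ℝ :=
  ((Finset.univ : Finset (Finset (KP n m c))).filter
      (fun S => ¬ ({KPchall c, KPsat c} ⊆ S))).sup'
    ⟨∅, by simp⟩ (Kworth c)

/-- One orientation of the penalty-edge relation of `K(φ)`. -/
def KPenaltyHalf : KP n m c → KP n m c → Prop := fun u v =>
  (∃ l l' : KLit n m c, u = KPlit c l ∧ v = KPlit c l' ∧
      ((l.1.2 = l'.1.2 ∧ l.1.1 ≠ l'.1.1) ∨ (l.1.1.1 = l'.1.1.1 ∧ l.1.1.2 ≠ l'.1.1.2))) ∨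
  (∃ (i : Fin n) (l : KLit n m c), u = KPvar c i ∧ v = KPlit c l ∧ l.1.1 = (i, false))

/-- `{u, v}` is a penalty edge of `K(φ)`. -/
def KPenalty (u v : KP n m c) : Prop := KPenaltyHalf c u v ∨ KPenaltyHalf c v u

/-- The weight `w⁺` of the positive edges of `K(φ)` other than the normalizer. -/
noncomputable def KPosWeight (u v : KP n m c) : ℝ := max (Kw0 c u v) 0

theorem card_KLit : Fintype.card (KLit n m c) = ∑ j, (c j).card := by
  rw [Fintype.card_subtype, Finset.card_filter, Fintype.sum_prod_type_right]
  simp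

theorem sum_two_pow_succ_le (n : ℕ) : ∑ i : Fin n, (2 : ℝ) ^ ((i : ℕ) + 1) ≤ 2 ^ (n + 1) - 2 := by
  rw [Fin.sum_univ_eq_sum_range (fun i => (2 : ℝ) ^ (i + 1)) n]
  refine le_of_eq ?_
  induction n with
  | zero => norm_num
  | succ k ih => rw [Finset.sum_range_succ, ih]; ring

theorem sum_ite_val_eq_zero_le (n : ℕ) : ∑ i : Fin n, (if (i : ℕ) = 0 then (1 : ℝ) else 0) ≤ 1 := by
  rw [Fin.sum_univ_eq_sum_range (fun i => if i = 0 then (1 : ℝ) else 0) n,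
    Finset.sum_ite_eq']
  split_ifs <;> norm_num

theorem sum_KPosWeight :
    ∑ u, ∑ v, KPosWeight c u v =
      2 * ((∑ j, (c j).card : ℕ) * 2 ^ (n + 3) + 2 * ∑ i : Fin n, (2 : ℝ) ^ ((i : ℕ) + 1) +
        ∑ i : Fin n, (if (i : ℕ) = 0 then (1 : ℝ) else 0)) := by
  have hpos (i : Fin n) (p : Prop) [Decidable p] :
      max ((2 : ℝ) ^ ((i : ℕ) + 1) + (if p then 1 else 0)) 0 =
        (2 : ℝ) ^ ((i : ℕ) + 1) + (if p then 1 else 0) :=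
    max_eq_left (by positivity)
  have hpow (i : Fin n) : max ((2 : ℝ) ^ ((i : ℕ) + 1)) 0 = (2 : ℝ) ^ ((i : ℕ) + 1) :=
    max_eq_left (by positivity)
  have hcl (p : Prop) [Decidable p] :
      max (if p then (2 : ℝ) ^ (n + 3) else 0) 0 = if p then (2 : ℝ) ^ (n + 3) else 0 :=
    max_eq_left (by positivity)
  have hpen (p : Prop) [Decidable p] :
      max (if p then -(2 : ℝ) ^ (m + n + 7) else 0) 0 = 0 :=
    max_eq_right (by split_ifs <;> simp)
  have hswap : ∑ j : Fin m, ∑ l : KLit n m c, (if l.1.2 = j then (2 : ℝ) ^ (n + 3) else 0) =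
      ∑ l : KLit n m c, ∑ j : Fin m, (if l.1.2 = j then (2 : ℝ) ^ (n + 3) else 0) :=
    Finset.sum_comm
  simp only [KPosWeight, Kw0, Fintype.sum_sum_type, hpos, hpow, hcl, hpen,
    Fintype.sum_bool, add_zero,
    Finset.sum_add_distrib, max_self, Finset.sum_const_zero, hswap, Finset.sum_ite_eq,
    Finset.mem_univ, if_true, Finset.sum_const, Finset.card_univ, card_KLit, nsmul_eq_mul,
    true_and, Bool.false_eq_true, false_and, if_false, Fintype.card_bool]
  push_cast
  ring

theorem sum_KPosWeight_le (h3 : ∀ j, (c j).card ≤ 3) :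
    ∑ u, ∑ v, KPosWeight c u v ≤ 2 ^ (m + n + 7) := by
  have hcard : ((∑ j, (c j).card : ℕ) : ℝ) ≤ 3 * m := by
    have := Finset.sum_le_card_nsmul Finset.univ (fun j => (c j).card) 3 (fun j _ => h3 j)
    rw [Finset.card_univ, Fintype.card_fin, smul_eq_mul, mul_comm] at this
    exact_mod_cast this
  have hm : (m : ℝ) + 1 ≤ 2 ^ m := by exact_mod_cast Nat.lt_two_pow_self
  have hp : (0 : ℝ) < 2 ^ n := by positivity
  have h1 := sum_two_pow_succ_le n
  have h2 := sum_ite_val_eq_zero_le n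
  have h4 := mul_le_mul_of_nonneg_right hcard hp.le
  have h5 := mul_le_mul_of_nonneg_right hm hp.le
  have h6 : (0 : ℝ) ≤ m * 2 ^ n := by positivity
  rw [sum_KPosWeight, pow_add _ (m + n), pow_add _ m, pow_add _ n]
  rw [pow_add _ n] at h1
  linarith

theorem Kw0_self (u : KP n m c) : Kw0 c u u = 0 := by
  rcases u with _ | _ | _ | _ <;> simp [Kw0]

theorem Kw_self (u : KP n m c) : Kw c u u = 0 := by
  have : KPchall c ≠ KPsat c := by simp [KPchall, KPsat]
  rw [Kw, Kw0_self, if_neg (by grind), add_zero]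

theorem Kworth_singleton (p : KP n m c) : Kworth c {p} = 0 := by
  simp [Kworth, Kw_self]

theorem Kworth_pair : Kworth c {KPchall c, KPsat c} = Kwnorm c := by
  have h : KPchall c ≠ KPsat c := by simp [KPchall, KPsat]
  simp only [Kworth, Finset.sum_pair h, Kw_self]
  simp [Kw, KPchall, KPsat, Kw0]

theorem Kworth_univ : Kworth c Finset.univ = 1 := by
  have h : KPchall c ≠ KPsat c := by simp [KPchall, KPsat]
  have hsplit (u v : KP n m c) :
      (if (u = KPchall c ∧ v = KPsat c) ∨ (u = KPsat c ∧ v = KPchall c) then Kwnorm c else 0) =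
        (if u = KPchall c then if v = KPsat c then Kwnorm c else 0 else 0) +
          if u = KPsat c then if v = KPchall c then Kwnorm c else 0 else 0 := by
    grind
  have hsum : ∑ u : KP n m c, ∑ v : KP n m c,
      (if (u = KPchall c ∧ v = KPsat c) ∨ (u = KPsat c ∧ v = KPchall c) then Kwnorm c else 0) =
        2 * Kwnorm c := by
    simp only [hsplit, Finset.sum_add_distrib]
    rw [Finset.sum_comm, Finset.sum_comm (f := fun u v =>
      if u = KPsat c then if v = KPchall c then Kwnorm c else 0 else 0)]
    simp only [Finset.sum_ite_eq', Finset.mem_univ, if_true]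
    ring
  simp only [Kworth, Kw, Finset.sum_add_distrib, hsum]
  rw [Kwnorm]
  ring

theorem sum_Kx (S : Finset (KP n m c)) : ∑ k ∈ S, Kx c k = if KPsat c ∈ S then 1 else 0 := by
  simp [Kx]

theorem KIsImputation_Kx : KIsImputation c (Kx c) := by
  refine ⟨by rw [sum_Kx, Kworth_univ, if_pos (Finset.mem_univ _)], fun p => ?_⟩
  rw [Kworth_singleton, Kx]
  positivity

theorem Kworth_le_of_sat_notMem {S : Finset (KP n m c)} (hS : KPsat c ∉ S) :
    Kworth c S ≤ (∑ u, ∑ v, KPosWeight c u v) / 2 := by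
  have hnn (u v : KP n m c) : 0 ≤ KPosWeight c u v := le_max_right _ _
  rw [Kworth]
  gcongr ?_ / 2
  calc ∑ u ∈ S, ∑ v ∈ S, Kw c u v ≤ ∑ u ∈ S, ∑ v ∈ S, KPosWeight c u v := by
        refine Finset.sum_le_sum fun u hu => Finset.sum_le_sum fun v hv => ?_
        rw [Kw, if_neg (by grind), add_zero]
        exact le_max_left _ _
    _ ≤ ∑ u ∈ S, ∑ v, KPosWeight c u v :=
        Finset.sum_le_sum fun u _ =>
          Finset.sum_le_univ_sum_of_nonneg (hnn u)
    _ ≤ ∑ u, ∑ v, KPosWeight c u v :=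
        Finset.sum_le_univ_sum_of_nonneg fun u => Finset.sum_nonneg fun v _ => hnn u v

theorem exists_Kw0_eq_penalty (h2 : ∃ j, 2 ≤ (c j).card) :
    ∃ u v : KP n m c, u ≠ v ∧
      Kw0 c u v = -2 ^ (m + n + 7) ∧ Kw0 c v u = -2 ^ (m + n + 7) := by
  obtain ⟨j, hj⟩ := h2
  obtain ⟨a, ha, b, hb, hab⟩ := Finset.one_lt_card.mp hj
  refine ⟨KPlit c ⟨(a, j), ha⟩, KPlit c ⟨(b, j), hb⟩, ?_, ?_, ?_⟩ <;>
    simp [KPlit, Kw0, hab, hab.symm]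

theorem sum_Kw0_le (h2 : ∃ j, 2 ≤ (c j).card) :
    ∑ u, ∑ v, Kw0 c u v ≤ ∑ u, ∑ v, KPosWeight c u v - 2 * 2 ^ (m + n + 7) := by
  obtain ⟨a, b, hab, h₁, h₂⟩ := exists_Kw0_eq_penalty c h2
  have hB : (0 : ℝ) ≤ 2 ^ (m + n + 7) := by positivity
  have hnn (u v : KP n m c) : 0 ≤ KPosWeight c u v - Kw0 c u v :=
    sub_nonneg.mpr (le_max_left _ _)
  have hrow (u v : KP n m c) (h : Kw0 c u v = -2 ^ (m + n + 7)) :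
      (2 : ℝ) ^ (m + n + 7) ≤ ∑ v, (KPosWeight c u v - Kw0 c u v) := by
    refine le_trans ?_ (Finset.single_le_sum (fun v _ => hnn u v) (Finset.mem_univ v))
    have : 0 ≤ KPosWeight c u v := le_max_right _ _
    linarith
  have hpair := Finset.sum_le_univ_sum_of_nonneg (s := {a, b})
    (f := fun u => ∑ v, (KPosWeight c u v - Kw0 c u v))
    (fun u => Finset.sum_nonneg fun v _ => hnn u v)
  rw [Finset.sum_pair hab] at hpair
  have ha := hrow a b h₁
  have hb := hrow b a h₂
  simp only [Finset.sum_sub_distrib] at hpair ha hb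
  linarith

theorem Kworth_le_Kwnorm_sub_one (h3 : ∀ j, (c j).card ≤ 3) (h2 : ∃ j, 2 ≤ (c j).card)
    {S : Finset (KP n m c)} (hS : KPsat c ∉ S) : Kworth c S ≤ Kwnorm c - 1 := by
  have h₁ := Kworth_le_of_sat_notMem c hS
  have h₂ := sum_Kw0_le c h2
  have h₃ := sum_KPosWeight_le c h3
  rw [Kwnorm]
  linarith

/-- A player other than `chall` and `sat` never has a larger surplus against `sat` than `sat` has
against it, because `{chall, sat}` is available to `sat`. -/
theorem Ksurplus_sat_le (h3 : ∀ j, (c j).card ≤ 3) (h2 : ∃ j, 2 ≤ (c j).card)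
    {i : KP n m c} (hc : i ≠ KPchall c) (hs : i ≠ KPsat c) :
    Ksurplus c i (KPsat c) (Kx c) ≤ Ksurplus c (KPsat c) i (Kx c) := by
  have hmem : {KPchall c, KPsat c} ∈ insert {KPsat c} (KIset c (KPsat c) i) := by
    simp [KIset, hc, hs]
  refine Finset.sup'_le _ _ fun S hS => le_trans ?_ (Finset.le_sup' _ hmem)
  have hS' : KPsat c ∉ S := by
    simp only [KIset, Finset.mem_insert, Finset.mem_filter, Finset.mem_univ, true_and] at hS
    rcases hS with rfl | hS
    · simpa using hs.symm
    · exact hS.2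
  have := Kworth_le_Kwnorm_sub_one c h3 h2 hS'
  rw [sum_Kx, sum_Kx, if_neg hS', if_pos (by simp), Kworth_pair]
  linarith

/--
**Kernel membership reduces to the `chall`/`sat` surplus comparison.**
Let `φ` be a satisfiable 3CNF formula in which some clause contains at least two literals,
and let `x` be the imputation of `K(φ)` assigning `1` to `sat` and `0` to every other
player.  Then `x` belongs to the kernel of `K(φ)` if and only if
`max_{S ∈ I_{chall,sat}} e(S, x) ≤ max_{S ∈ I_{sat,chall}} e(S, x)`.
-/
theorem K_kernel_iff_surplus_ineq (n m : ℕ)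
    (c : Fin m → Finset (Fin n × Bool))
    (h3 : ∀ j, (c j).card ≤ 3) (h2 : ∃ j, 2 ≤ (c j).card)
    (hsat : ∃ σ, KSat c σ) :
    KInKernel c (Kx c) ↔
      Ksurplus c (KPchall c) (KPsat c) (Kx c) ≤ Ksurplus c (KPsat c) (KPchall c) (Kx c) := by
  have hne : KPchall c ≠ KPsat c := by simp [KPchall, KPsat]
  constructor
  · intro h
    by_contra! hlt
    simpa [Kx, Kworth_singleton] using h.2 _ _ hne hlt
  · refine fun h => ⟨KIsImputation_Kx c, fun i j hij hlt => ?_⟩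
    rw [Kworth_singleton, Kx, if_neg]
    rintro rfl
    by_cases hc : i = KPchall c
    · exact absurd h (not_le.mpr (hc ▸ hlt))
    · exact absurd (Ksurplus_sat_le c h3 h2 hc hij) (not_le.mpr hlt)
end

section
/- Let φ be a satisfiable 3CNF formula over variables α₁, …, α_n with clauses c₁, …, c_m in which some clause contains at least two literals, let K(φ) be the associated graph game, and let x be the imputation assigning payoff 1 to player sat and 0 to every other player. Then max_{S ∈ I_{chall,sat}} e(S, x) = m·2^{n+3} + max over satisfying assignments σ of φ of Σ_{α_i : σ(α_i)=true} 2^i. -/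
set_option synthInstance.maxSize 1000
set_option maxHeartbeats 1000000

variable {n m : ℕ} (c : Fin m → Finset (Fin n × Bool))

/-- Two literal occurrences joined by a penalty edge. -/
def KConflict (l l' : KLit n m c) : Prop :=
  (l.1.2 = l'.1.2 ∧ l.1.1 ≠ l'.1.1) ∨ (l.1.1.1 = l'.1.1.1 ∧ l.1.1.2 ≠ l'.1.1.2)

instance : ∀ l l' : KLit n m c, Decidable (KConflict c l l') := fun l l' => by
  unfold KConflict; infer_instance

/-- The number of penalty edges inside the coalition `S`. -/
noncomputable def KPenaltyCount (S : Finset (KP n m c)) : ℝ :=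
  (∑ l : KLit n m c, ∑ l' : KLit n m c,
      if KPlit c l ∈ S ∧ KPlit c l' ∈ S ∧ KConflict c l l' then (1:ℝ) else 0) / 2 +
    ∑ i : Fin n, ∑ l : KLit n m c,
      if KPvar c i ∈ S ∧ KPlit c l ∈ S ∧ l.1.1 = (i, false) then (1:ℝ) else 0

/-- The literal occurrences in `S` whose clause player also belongs to `S`. -/
noncomputable def KServed (S : Finset (KP n m c)) : Finset (KLit n m c) :=
  Finset.univ.filter (fun l => KPlit c l ∈ S ∧ KPcl c l.1.2 ∈ S)

theorem sum_sum_ite_nonneg {α β : Type*} [Fintype α] [Fintype β] (p : α → β → Prop)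
    {_ : ∀ a b, Decidable (p a b)} : (0:ℝ) ≤ ∑ a, ∑ b, if p a b then (1:ℝ) else 0 :=
  Finset.sum_nonneg fun _ _ => Finset.sum_nonneg fun _ _ => by split_ifs <;> norm_num

theorem Kworth_eq_sum_Kw0 (S : Finset (KP n m c)) (hs : KPsat c ∉ S) :
    Kworth c S = (∑ u ∈ S, ∑ v ∈ S, Kw0 c u v) / 2 := by
  unfold Kworth
  congr 1
  refine Finset.sum_congr rfl fun u hu => Finset.sum_congr rfl fun v hv => ?_
  have hu' : u ≠ KPsat c := fun h => hs (h ▸ hu)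
  have hv' : v ≠ KPsat c := fun h => hs (h ▸ hv)
  simp [Kw, hu', hv']

theorem Kworth_eq (S : Finset (KP n m c)) (hc : KPchall c ∈ S) (hs : KPsat c ∉ S) :
    Kworth c S = ((KServed c S).card : ℝ) * (2:ℝ)^(n+3) +
      (∑ i : Fin n, if KPvar c i ∈ S then (2:ℝ)^((i:ℕ)+1) else 0) -
      (2:ℝ)^(m+n+7) * KPenaltyCount c S := by
  have hcard : ((KServed c S).card : ℝ) * (2:ℝ)^(n+3) =
      ∑ l : KLit n m c,
        if KPlit c l ∈ S ∧ KPcl c l.1.2 ∈ S then (2:ℝ)^(n+3) else 0 := by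
    rw [← Finset.sum_filter, Finset.sum_const, nsmul_eq_mul, KServed]
  have hcl : ∀ l : KLit n m c,
      (∑ j : Fin m, if KPlit c l ∈ S then (if KPcl c j ∈ S then
        (if l.1.2 = j then (2:ℝ)^(n+3) else 0) else 0) else 0) =
      if KPlit c l ∈ S ∧ KPcl c l.1.2 ∈ S then (2:ℝ)^(n+3) else 0 := by
    intro l
    rw [Finset.sum_eq_single l.1.2]
    · simp [ite_and]
    · intro j _ hj
      simp [hj.symm]
    · simp
  have key : ∑ u ∈ S, ∑ v ∈ S, Kw0 c u v =
      ∑ u, ∑ v, if u ∈ S then (if v ∈ S then Kw0 c u v else 0) else 0 := by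
    simp [Finset.sum_ite_mem, Finset.sum_ite_irrel]
  have hs' : (Sum.inr (Sum.inr (Sum.inr true)) : KP n m c) ∉ S := hs
  have hvl : ∀ (i : Fin n) (l : KLit n m c),
      (if KPvar c i ∈ S then (if KPlit c l ∈ S then
        (if l.1.1 = (i, false) then -((2:ℝ)^(m+n+7)) else 0) else 0) else 0) =
      -((2:ℝ)^(m+n+7)) *
        if KPvar c i ∈ S ∧ KPlit c l ∈ S ∧ l.1.1 = (i, false) then (1:ℝ) else 0 := by
    intro i l
    simp only [ite_and]
    split_ifs <;> simp
  have hll : ∀ l l' : KLit n m c,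
      (if KPlit c l ∈ S then (if KPlit c l' ∈ S then
        (if KConflict c l l' then -((2:ℝ)^(m+n+7)) else 0) else 0) else 0) =
      -((2:ℝ)^(m+n+7)) *
        if KPlit c l ∈ S ∧ KPlit c l' ∈ S ∧ KConflict c l l' then (1:ℝ) else 0 := by
    intro l l'
    simp only [ite_and]
    split_ifs <;> simp
  set Q : KP n m c → KP n m c → ℝ :=
    fun u v => if u ∈ S then (if v ∈ S then Kw0 c u v else 0) else 0 with hQ
  have symm : ∀ u v, Q u v = Q v u := by
    have h0 : ∀ u v, Kw0 c u v = Kw0 c v u := by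
      rintro (i | j | l | b) (i' | j' | l' | b') <;> try rfl
      simp only [Kw0, ne_comm, eq_comm]
    intro u v
    simp only [hQ, h0 u v]
    split_ifs <;> rfl
  have blocks : ∑ u, ∑ v, Q u v =
      (∑ l : KLit n m c, ∑ l' : KLit n m c, Q (KPlit c l) (KPlit c l')) +
      2 * (∑ i : Fin n, ∑ l : KLit n m c, Q (KPvar c i) (KPlit c l)) +
      2 * (∑ l : KLit n m c, ∑ j : Fin m, Q (KPlit c l) (KPcl c j)) +
      2 * (∑ i : Fin n, Q (KPvar c i) (KPchall c)) := by
    have z1 : ∀ i i', Q (Sum.inl i) (Sum.inl i') = 0 := by simp [hQ, Kw0]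
    have z2 : ∀ i j, Q (Sum.inl i) (Sum.inr (Sum.inl j)) = 0 := by simp [hQ, Kw0]
    have z3 : ∀ j i, Q (Sum.inr (Sum.inl j)) (Sum.inl i) = 0 := by simp [hQ, Kw0]
    have z4 : ∀ j j', Q (Sum.inr (Sum.inl j)) (Sum.inr (Sum.inl j')) = 0 := by simp [hQ, Kw0]
    have z5 : ∀ j b, Q (Sum.inr (Sum.inl j)) (Sum.inr (Sum.inr (Sum.inr b))) = 0 := by
      simp [hQ, Kw0]
    have z6 : ∀ j b, Q (Sum.inr (Sum.inr (Sum.inr b))) (Sum.inr (Sum.inl j)) = 0 := by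
      simp [hQ, Kw0]
    have z7 : ∀ l b, Q (Sum.inr (Sum.inr (Sum.inl l))) (Sum.inr (Sum.inr (Sum.inr b))) = 0 := by
      simp [hQ, Kw0]
    have z8 : ∀ l b, Q (Sum.inr (Sum.inr (Sum.inr b))) (Sum.inr (Sum.inr (Sum.inl l))) = 0 := by
      simp [hQ, Kw0]
    have z9 : ∀ b b', Q (Sum.inr (Sum.inr (Sum.inr b))) (Sum.inr (Sum.inr (Sum.inr b'))) = 0 := by
      simp [hQ, Kw0]
    have z10 : ∀ u, Q u (Sum.inr (Sum.inr (Sum.inr true))) = 0 := by simp [hQ, hs']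
    have z11 : ∀ u, Q (Sum.inr (Sum.inr (Sum.inr true))) u = 0 := by simp [hQ, hs']
    have e1 : (∑ l : KLit n m c, ∑ i : Fin n, Q (KPlit c l) (KPvar c i)) =
        ∑ i : Fin n, ∑ l : KLit n m c, Q (KPvar c i) (KPlit c l) := by
      rw [Finset.sum_comm]
      simp only [symm (KPlit c _) (KPvar c _)]
    have e2 : (∑ j : Fin m, ∑ l : KLit n m c, Q (KPcl c j) (KPlit c l)) =
        ∑ l : KLit n m c, ∑ j : Fin m, Q (KPlit c l) (KPcl c j) := by
      rw [Finset.sum_comm]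
      simp only [symm (KPlit c _) (KPcl c _)]
    have e3 : (∑ i : Fin n, Q (KPchall c) (KPvar c i)) =
        ∑ i : Fin n, Q (KPvar c i) (KPchall c) := by
      simp only [symm (KPchall c) (KPvar c _)]
    simp only [KPvar, KPcl, KPlit, KPchall] at e1 e2 e3 ⊢
    simp only [Fintype.sum_sum_type, Fintype.sum_bool, z1, z2, z3, z4, z5, z6, z7, z8, z9, z10,
      z11, Finset.sum_add_distrib, Finset.sum_const_zero, e1, e2, e3]
    ring
  have b1 : (∑ l : KLit n m c, ∑ l' : KLit n m c, Q (KPlit c l) (KPlit c l')) =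
      -((2:ℝ)^(m+n+7)) * ∑ l : KLit n m c, ∑ l' : KLit n m c,
        if KPlit c l ∈ S ∧ KPlit c l' ∈ S ∧ KConflict c l l' then (1:ℝ) else 0 := by
    simp only [Finset.mul_sum, ← hll]
    refine Finset.sum_congr rfl fun l _ => Finset.sum_congr rfl fun l' _ => ?_
    rfl
  have b2 : (∑ i : Fin n, ∑ l : KLit n m c, Q (KPvar c i) (KPlit c l)) =
      -((2:ℝ)^(m+n+7)) * ∑ i : Fin n, ∑ l : KLit n m c,
        if KPvar c i ∈ S ∧ KPlit c l ∈ S ∧ l.1.1 = (i, false) then (1:ℝ) else 0 := by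
    simp only [Finset.mul_sum, ← hvl]
    rfl
  have b3 : (∑ l : KLit n m c, ∑ j : Fin m, Q (KPlit c l) (KPcl c j)) =
      ((KServed c S).card : ℝ) * (2:ℝ)^(n+3) := by
    rw [hcard]
    exact Finset.sum_congr rfl fun l _ => hcl l
  have b4 : (∑ i : Fin n, Q (KPvar c i) (KPchall c)) =
      ∑ i : Fin n, if KPvar c i ∈ S then (2:ℝ)^((i:ℕ)+1) else 0 := by
    refine Finset.sum_congr rfl fun i _ => ?_
    have h : Kw0 c (KPvar c i) (KPchall c) = (2:ℝ)^((i:ℕ)+1) := by simp [Kw0, KPvar, KPchall]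
    simp only [hQ, hc, if_true, h]
  rw [Kworth_eq_sum_Kw0 c S hs, key, blocks, b1, b2, b3, b4, KPenaltyCount]
  ring

theorem sum_two_pow_le (p : Fin n → Prop) [DecidablePred p] :
    (∑ i : Fin n, if p i then (2:ℝ)^((i:ℕ)+1) else 0) ≤ 2^(n+1) - 2 := by
  have h1 : (∑ i : Fin n, if p i then (2:ℝ)^((i:ℕ)+1) else 0) ≤
      ∑ i : Fin n, (2:ℝ)^((i:ℕ)+1) :=
    Finset.sum_le_sum fun i _ => by split_ifs <;> [exact le_rfl; positivity]
  have h2 : (∑ i : Fin n, (2:ℝ)^((i:ℕ)+1)) = 2^(n+1) - 2 := by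
    rw [Fin.sum_univ_eq_sum_range (fun i => (2:ℝ)^(i+1)) n]
    simp only [pow_succ, ← Finset.sum_mul, geom_sum_eq (by norm_num : (2:ℝ) ≠ 1)]
    ring
  linarith

theorem Kval_nonneg (σ : Fin n → Bool) : 0 ≤ Kval σ :=
  Finset.sum_nonneg fun i _ => by split_ifs <;> positivity

theorem card_KLit_le (h3 : ∀ j, (c j).card ≤ 3) : Fintype.card (KLit n m c) ≤ 3 * m := by
  have h := Finset.card_le_mul_card_image (f := fun l : KLit n m c => l.1.2)
    (Finset.univ : Finset (KLit n m c)) 3 (fun j _ => by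
      refine le_trans (Finset.card_le_card_of_injOn (fun l => l.1.1) (t := c j) ?_ ?_) (h3 j)
      · intro l hl
        have hl' : l.1.2 = j := by simpa using hl
        exact hl' ▸ l.2
      · intro l hl l' hl' h
        have h1 : l.1.2 = j := by simpa using hl
        have h2 : l'.1.2 = j := by simpa using hl'
        exact Subtype.ext (Prod.ext h (h1.trans h2.symm)))
  have h' : (Finset.univ.image (fun l : KLit n m c => l.1.2)).card ≤ m := by
    simpa using Finset.card_le_univ (Finset.univ.image (fun l : KLit n m c => l.1.2))
  rw [Finset.card_univ] at h
  omega

theorem KPenaltyCount_nonneg (S : Finset (KP n m c)) : 0 ≤ KPenaltyCount c S := by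
  unfold KPenaltyCount
  exact add_nonneg (div_nonneg (sum_sum_ite_nonneg _) zero_le_two) (sum_sum_ite_nonneg _)

theorem one_le_sum_sum_ite {α β : Type*} [Fintype α] [Fintype β] (p : α → β → Prop)
    {_ : ∀ a b, Decidable (p a b)} {a : α} {b : β} (h : p a b) :
    (1:ℝ) ≤ ∑ a, ∑ b, if p a b then (1:ℝ) else 0 := by
  have hn : ∀ a b, (0:ℝ) ≤ if p a b then (1:ℝ) else 0 := fun a b => by split_ifs <;> norm_num
  calc (1:ℝ) = if p a b then (1:ℝ) else 0 := by rw [if_pos h]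
    _ ≤ ∑ b, if p a b then (1:ℝ) else 0 :=
      Finset.single_le_sum (f := fun b => if p a b then (1:ℝ) else 0)
        (fun b _ => hn a b) (Finset.mem_univ b)
    _ ≤ _ := Finset.single_le_sum (f := fun a => ∑ b, if p a b then (1:ℝ) else 0)
        (fun a _ => Finset.sum_nonneg fun b _ => hn a b) (Finset.mem_univ a)

/-- A coalition with `chall`, without `sat`, spanning a penalty edge has nonpositive worth. -/
theorem Kworth_nonpos_of_half_le (h3 : ∀ j, (c j).card ≤ 3) (S : Finset (KP n m c))
    (hc : KPchall c ∈ S) (hs : KPsat c ∉ S) (hP : 1 / 2 ≤ KPenaltyCount c S) :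
    Kworth c S ≤ 0 := by
  rw [Kworth_eq c S hc hs]
  have hv := sum_two_pow_le (fun i : Fin n => KPvar c i ∈ S)
  have hk : ((KServed c S).card : ℝ) ≤ 3 * m := by
    exact_mod_cast (Finset.card_le_univ _).trans (card_KLit_le c h3)
  have hm : (m:ℝ) ≤ 2^m := by exact_mod_cast Nat.lt_two_pow_self.le
  have hm1 : (1:ℝ) ≤ 2^m := one_le_pow₀ (by norm_num)
  have hn : (0:ℝ) < 2^n := by positivity
  have hP' : (2:ℝ)^(m+n+7) * (1/2) ≤ (2:ℝ)^(m+n+7) * KPenaltyCount c S := by gcongr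
  have hk' : ((KServed c S).card : ℝ) * (2:ℝ)^(n+3) ≤ 3 * 2^m * 2^(n+3) := by
    gcongr
    linarith
  have hnm : (2:ℝ)^n ≤ 2^m * 2^n := le_mul_of_one_le_left hn.le hm1
  simp only [pow_add] at *
  nlinarith

/-- The worth of a coalition containing `chall` but not `sat` is bounded by the value of some
satisfying assignment plus the full clause reward. -/
theorem Kworth_le (h3 : ∀ j, (c j).card ≤ 3) (hsat : ∃ σ, KSat c σ) (S : Finset (KP n m c))
    (hc : KPchall c ∈ S) (hs : KPsat c ∉ S) :
    ∃ σ, KSat c σ ∧ Kworth c S ≤ (m : ℝ) * (2:ℝ)^(n+3) + Kval σ := by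
  obtain ⟨σ₀, hσ₀⟩ := hsat
  have hpos : (0:ℝ) ≤ (m : ℝ) * (2:ℝ)^(n+3) + Kval σ₀ := by
    have := Kval_nonneg σ₀
    positivity
  by_cases hP : 1 / 2 ≤ KPenaltyCount c S
  · exact ⟨σ₀, hσ₀, (Kworth_nonpos_of_half_le c h3 S hc hs hP).trans hpos⟩
  have hll : ∀ l l' : KLit n m c, KPlit c l ∈ S → KPlit c l' ∈ S → ¬ KConflict c l l' := by
    intro l l' hl hl' h
    apply hP
    exact le_add_of_le_of_nonneg (div_le_div_of_nonneg_right
      (one_le_sum_sum_ite _ (a := l) (b := l') ⟨hl, hl', h⟩) zero_le_two) (sum_sum_ite_nonneg _)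
  have hvl : ∀ (i : Fin n) (l : KLit n m c), KPvar c i ∈ S → KPlit c l ∈ S →
      l.1.1 ≠ (i, false) := by
    intro i l hi hl h
    apply hP
    exact le_add_of_nonneg_of_le (div_nonneg (sum_sum_ite_nonneg _) zero_le_two)
      (one_half_lt_one.le.trans (one_le_sum_sum_ite _ (a := i) (b := l) ⟨hi, hl, h⟩))
  have hinj : Set.InjOn (fun l : KLit n m c => l.1.2) (KServed c S) := by
    intro l hl l' hl' h
    simp only [KServed, Finset.coe_filter, Set.mem_ofPred_eq] at hl hl'
    by_contra hne
    refine hll l l' hl.2.1 hl'.2.1 (Or.inl ⟨h, fun h' => hne ?_⟩)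
    exact Subtype.ext (Prod.ext h' h)
  have hcard := Finset.card_image_of_injOn hinj
  have hpen : 0 ≤ (2:ℝ)^(m+n+7) * KPenaltyCount c S :=
    mul_nonneg (by positivity) (KPenaltyCount_nonneg c S)
  have hW := Kworth_eq c S hc hs
  have hp : (0:ℝ) < 2^(n+3) := by positivity
  by_cases hU : (KServed c S).image (fun l => l.1.2) = Finset.univ
  · set σ : Fin n → Bool := fun i => decide (KPvar c i ∈ S ∨
      ∃ l : KLit n m c, KPlit c l ∈ S ∧ l.1.1 = (i, true)) with hσ
    refine ⟨σ, fun j => ?_, ?_⟩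
    · obtain ⟨l, hl, hlj⟩ := Finset.mem_image.1 (hU ▸ Finset.mem_univ j)
      have hlS : KPlit c l ∈ S := (Finset.mem_filter.1 hl).2.1
      refine ⟨l.1.1, hlj ▸ l.2, ?_⟩
      rcases hb : l.1.1.2 with _ | _
      · simp only [hσ, decide_eq_false_iff_not]
        rintro (h | ⟨l', hl', h⟩)
        · exact hvl _ l h hlS (Prod.ext rfl hb)
        · exact hll l l' hlS hl' (Or.inr ⟨by simp [h], by simp [h, hb]⟩)
      · simp only [hσ, decide_eq_true_eq]
        exact Or.inr ⟨l, hlS, Prod.ext rfl hb⟩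
    · rw [hU, Finset.card_univ, Fintype.card_fin] at hcard
      rw [hW, ← hcard]
      have : (∑ i : Fin n, if KPvar c i ∈ S then (2:ℝ)^((i:ℕ)+1) else 0) ≤ Kval σ := by
        refine Finset.sum_le_sum fun i _ => ?_
        by_cases hi : KPvar c i ∈ S
        · simp [hi, hσ]
        · rw [if_neg hi]
          split_ifs <;> positivity
      linarith
  · refine ⟨σ₀, hσ₀, ?_⟩
    have hlt : (KServed c S).card + 1 ≤ m := by
      rw [← hcard]
      simpa using Finset.card_lt_univ_of_notMem
        (Classical.not_forall.1 fun h => hU (Finset.eq_univ_of_forall h)).choose_spec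
    have hlt' : ((KServed c S).card : ℝ) + 1 ≤ m := by exact_mod_cast hlt
    have hv := sum_two_pow_le (fun i : Fin n => KPvar c i ∈ S)
    have h0 := Kval_nonneg σ₀
    have h1 : (((KServed c S).card : ℝ) + 1) * 2^(n+3) ≤ m * 2^(n+3) := by gcongr
    have h2 : (2:ℝ)^(n+1) ≤ 2^(n+3) := pow_le_pow_right₀ (by norm_num) (by omega)
    linarith

/-- Every satisfying assignment is realised by a coalition of the corresponding worth. -/
theorem exists_le_Kworth (σ : Fin n → Bool) (hσ : KSat c σ) :
    ∃ S : Finset (KP n m c), KPchall c ∈ S ∧ KPsat c ∉ S ∧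
      (m : ℝ) * (2:ℝ)^(n+3) + Kval σ ≤ Kworth c S := by
  classical
  choose f hf hfσ using hσ
  set S : Finset (KP n m c) := Finset.univ.filter
    (Sum.elim (fun i => σ i = true) (Sum.elim (fun _ => True)
      (Sum.elim (fun l => l.1.1 = f l.1.2) (fun b => b = false)))) with hS
  have hvar : ∀ i, KPvar c i ∈ S ↔ σ i = true := by simp [hS, KPvar]
  have hcl : ∀ j, KPcl c j ∈ S := by simp [hS, KPcl]
  have hlit : ∀ l, KPlit c l ∈ S ↔ l.1.1 = f l.1.2 := by simp [hS, KPlit]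
  have hchall : KPchall c ∈ S := by simp [hS, KPchall]
  have hnsat : KPsat c ∉ S := by simp [hS, KPsat]
  refine ⟨S, hchall, hnsat, ?_⟩
  have hP : KPenaltyCount c S = 0 := by
    have h1 : ∀ l l' : KLit n m c, ¬ (KPlit c l ∈ S ∧ KPlit c l' ∈ S ∧ KConflict c l l') := by
      rintro l l' ⟨hl, hl', ⟨h, h'⟩ | ⟨h, h'⟩⟩
      · rw [hlit] at hl hl'
        exact h' (by rw [hl, hl', h])
      · rw [hlit] at hl hl'
        rw [hl, hl'] at h h'
        exact h' (by rw [← hfσ, ← hfσ, h])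
    have h2 : ∀ (i : Fin n) (l : KLit n m c),
        ¬ (KPvar c i ∈ S ∧ KPlit c l ∈ S ∧ l.1.1 = (i, false)) := by
      rintro i l ⟨hi, hl, h⟩
      rw [hvar] at hi
      rw [hlit, h] at hl
      have := hfσ l.1.2
      rw [← hl] at this
      simp [hi] at this
    simp [KPenaltyCount, h1, h2]
  have hk : m ≤ (KServed c S).card := by
    have := Finset.card_le_card_of_injOn (s := (Finset.univ : Finset (Fin m)))
      (t := KServed c S) (fun j => ⟨(f j, j), hf j⟩)
      (fun j _ => by simp [KServed, hlit, hcl])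
      (fun j _ j' _ h => congrArg (fun l : KLit n m c => l.1.2) h)
    simpa using this
  have hk' : (m:ℝ) * 2^(n+3) ≤ ((KServed c S).card : ℝ) * 2^(n+3) := by gcongr
  rw [Kworth_eq c S hchall hnsat, hP]
  simp only [hvar]
  rw [mul_zero, sub_zero, Kval]
  linarith

theorem sum_Kx_of_notMem (S : Finset (KP n m c)) (hs : KPsat c ∉ S) :
    ∑ k ∈ S, Kx c k = 0 :=
  Finset.sum_eq_zero fun _ hk => if_neg (ne_of_mem_of_not_mem hk hs)

/--
**The maximum excess of `chall` against `sat`.**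
Let `φ` be a satisfiable 3CNF formula (some clause having at least two literals) and `x`
the imputation of `K(φ)` assigning `1` to `sat` and `0` to every other player.  Then
`max_{S ∈ I_{chall,sat}} e(S, x) = m·2^(n+3) + max_{σ ⊨ φ} ∑_{α_i : σ(α_i)=true} 2^i`.
-/
theorem K_surplus_chall_sat (n m : ℕ)
    (c : Fin m → Finset (Fin n × Bool))
    (h3 : ∀ j, (c j).card ≤ 3) (h2 : ∃ j, 2 ≤ (c j).card)
    (hsat : ∃ σ, KSat c σ) :
    Ksurplus c (KPchall c) (KPsat c) (Kx c) =
      (m : ℝ) * (2:ℝ)^(n+3) +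
        (Finset.univ.filter (fun σ => KSat c σ)).sup'
          (by obtain ⟨σ, hσ⟩ := hsat
              exact ⟨σ, Finset.mem_filter.2 ⟨Finset.mem_univ _, hσ⟩⟩)
          Kval := by
  apply le_antisymm
  · refine Finset.sup'_le _ _ fun S hS => ?_
    have hS' : KPchall c ∈ S ∧ KPsat c ∉ S := by
      rcases Finset.mem_insert.1 hS with rfl | hS
      · simp [KPchall, KPsat]
      · simpa [KIset] using hS
    obtain ⟨σ, hσ, hle⟩ := Kworth_le c h3 hsat S hS'.1 hS'.2
    rw [sum_Kx_of_notMem c S hS'.2, sub_zero]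
    refine hle.trans (add_le_add le_rfl ?_)
    exact Finset.le_sup' Kval (Finset.mem_filter.2 ⟨Finset.mem_univ _, hσ⟩)
  · rw [← le_sub_iff_add_le']
    refine Finset.sup'_le _ _ fun σ hσ => ?_
    obtain ⟨S, h1, h2, hle⟩ := exists_le_Kworth c σ (Finset.mem_filter.1 hσ).2
    rw [le_sub_iff_add_le']
    refine hle.trans ?_
    rw [← sub_zero (Kworth c S), ← sum_Kx_of_notMem c S h2]
    exact Finset.le_sup' (fun S => Kworth c S - ∑ k ∈ S, Kx c k)
      (Finset.mem_insert_of_mem (by simp [KIset, h1, h2]))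
end
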